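/- arXiv:1212.4175 — 2 statements merged into one kernel-verified Lean document; each statement's English description precedes it below -/
import Mathlib

section
/- Let G be a finite simple graph with bipartition (U, W). Then the family {N(U') : U' ⊆ U} of neighbourhood-unions of subsets of U has the same cardinality as the set MSS(G) of maximal stable sets of G. In fact, the map sending a maximal stable set S to N(U ∩ S) is a bijection from MSS(G) onto {N(U') : U' ⊆ U}. -/
/-- A set of vertices is stable (independent): no two of its vertices are adjacent. -/
def IsStable {V : Type*} (G : SimpleGraph V) (S : Set V) : Prop :=
  ∀ ⦃u⦄, u ∈ S → ∀ ⦃v⦄, v ∈ S → ¬G.Adj u v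

/-- A maximal stable set: stable, and every vertex outside has a neighbour inside. -/
def IsMaxStable {V : Type*} (G : SimpleGraph V) (S : Set V) : Prop :=
  IsStable G S ∧ ∀ v ∉ S, ∃ u ∈ S, G.Adj v u

/-- The set of all maximal stable sets of `G`. -/
def MSS {V : Type*} (G : SimpleGraph V) : Set (Set V) := {S | IsMaxStable G S}

/-- The number of maximal stable sets of `G` containing all vertices of `X`. -/
noncomputable def mssOn {V : Type*} (G : SimpleGraph V) (X : Set V) : ℕ :=
  {S | S ∈ MSS G ∧ X ⊆ S}.ncard

/-- A vertex is rare if it lies in at most half of the maximal stable sets. -/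
def Rare {V : Type*} (G : SimpleGraph V) (v : V) : Prop :=
  2 * mssOn G {v} ≤ (MSS G).ncard

/-- The neighbourhood of a set of vertices: all vertices with a neighbour in `A`. -/
def NSet {V : Type*} (G : SimpleGraph V) (A : Set V) : Set V := {v | ∃ u ∈ A, G.Adj v u}

/-- A bipartition of `G`: a partition of the vertex set into two stable sets. -/
def IsBipartition {V : Type*} (G : SimpleGraph V) (U W : Set V) : Prop :=
  U ∪ W = Set.univ ∧ Disjoint U W ∧ IsStable G U ∧ IsStable G W

theorem IsMaxStable.mem_iff {V : Type*} {G : SimpleGraph V} {S : Set V} (hS : IsMaxStable G S)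
    (v : V) : v ∈ S ↔ v ∉ NSet G S := by
  constructor
  · rintro hv ⟨u, hu, h⟩
    exact hS.1 hv hu h
  · intro h
    by_contra hv
    exact h (hS.2 v hv)

theorem IsBipartition.mem_right_iff {V : Type*} {G : SimpleGraph V} {U W : Set V}
    (hb : IsBipartition G U W) (v : V) : v ∈ W ↔ v ∉ U := by
  have hv : v ∈ U ∪ W := hb.1 ▸ Set.mem_univ v
  exact ⟨fun hW hU => Set.disjoint_left.mp hb.2.1 hU hW, fun h => hv.resolve_left h⟩

theorem IsBipartition.mem_iff_not_mem_of_adj {V : Type*} {G : SimpleGraph V} {U W : Set V}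
    (hb : IsBipartition G U W) {u v : V} (h : G.Adj u v) : u ∈ U ↔ v ∉ U := by
  refine ⟨fun hu hv => hb.2.2.1 hu hv h, fun hv => ?_⟩
  by_contra hu
  exact hb.2.2.2 ((hb.mem_right_iff u).2 hu) ((hb.mem_right_iff v).2 hv) h

/-- A maximal stable set is determined by the neighbourhood of its part in one side. -/
theorem IsBipartition.injOn_nSet_inter {V : Type*} {G : SimpleGraph V} {U W : Set V}
    (hb : IsBipartition G U W) : Set.InjOn (fun S => NSet G (U ∩ S)) (MSS G) := by
  have right : ∀ S ∈ MSS G, ∀ v ∉ U, v ∈ S ↔ v ∉ NSet G (U ∩ S) := by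
    intro S hS v hv
    rw [IsMaxStable.mem_iff hS v, not_iff_not]
    constructor
    · rintro ⟨u, hu, h⟩
      exact ⟨u, ⟨(hb.mem_iff_not_mem_of_adj h.symm).2 hv, hu⟩, h⟩
    · rintro ⟨u, hu, h⟩
      exact ⟨u, hu.2, h⟩
  intro S hS T hT hST
  have hout : ∀ v ∉ U, v ∈ S ↔ v ∈ T := fun v hv => by
    rw [right S hS v hv, right T hT v hv]
    exact not_congr (Set.ext_iff.1 hST v)
  ext v
  by_cases hv : v ∈ U
  · rw [IsMaxStable.mem_iff hS v, IsMaxStable.mem_iff hT v, not_iff_not]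
    refine exists_congr fun u => and_congr_left fun h => ?_
    exact hout u ((hb.mem_iff_not_mem_of_adj h).1 hv)
  · exact hout v hv

/-- The neighbourhood of a subset `A` of one side arises from the maximal stable set made of the
non-neighbours of `A` in the other side and of all vertices without a neighbour among those. -/
theorem IsBipartition.exists_mem_mss {V : Type*} {G : SimpleGraph V} {U W A : Set V}
    (hb : IsBipartition G U W) (hA : A ⊆ U) : ∃ S ∈ MSS G, NSet G (U ∩ S) = NSet G A := by
  set R := W \ NSet G A with hR
  have hRU : ∀ v, v ∈ R ↔ v ∉ U ∧ v ∉ NSet G A := fun v => by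
    rw [hR, Set.mem_sdiff, hb.mem_right_iff]
  have hAR : ∀ a ∈ A, a ∉ NSet G R := by
    rintro a ha ⟨r, hr, h⟩
    exact ((hRU r).1 hr).2 ⟨a, ha, h.symm⟩
  refine ⟨R ∪ U \ NSet G R, ⟨?_, ?_⟩, ?_⟩
  · rintro u (hu | hu) v (hv | hv) h
    · exact hb.2.2.2 hu.1 hv.1 h
    · exact hv.2 ⟨u, hu, h.symm⟩
    · exact hu.2 ⟨v, hv, h⟩
    · exact hb.2.2.1 hu.1 hv.1 h
  · intro v hv
    rw [Set.mem_union, not_or] at hv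
    by_cases hvU : v ∈ U
    · obtain ⟨r, hr, h⟩ : v ∈ NSet G R := by
        by_contra hn
        exact hv.2 ⟨hvU, hn⟩
      exact ⟨r, Or.inl hr, h⟩
    · obtain ⟨a, ha, h⟩ : v ∈ NSet G A := by
        by_contra hn
        exact hv.1 ((hRU v).2 ⟨hvU, hn⟩)
      exact ⟨a, Or.inr ⟨hA ha, hAR a ha⟩, h⟩
  · ext v
    constructor
    · rintro ⟨u, ⟨huU, hu⟩, h⟩
      have huR : u ∉ NSet G R := hu.elim (fun hr => absurd huU ((hRU u).1 hr).1) And.right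
      by_contra hn
      exact huR ⟨v, (hRU v).2 ⟨(hb.mem_iff_not_mem_of_adj h.symm).1 huU, hn⟩, h.symm⟩
    · rintro ⟨a, ha, h⟩
      exact ⟨a, ⟨hA ha, Or.inr ⟨hA ha, hAR a ha⟩⟩, h⟩

/-- For a finite bipartite graph with bipartition `(U, W)`, the family of neighbourhoods of
subsets of `U` has the same cardinality as the set of maximal stable sets; indeed
`S ↦ N(U ∩ S)` is a bijection from `MSS(G)` onto `{N(U') : U' ⊆ U}`. -/
theorem mss_bij_neighborhood_family {V : Type} [Fintype V] (G : SimpleGraph V) (U W : Set V)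
    (hb : IsBipartition G U W) :
    {X : Set V | ∃ U' ⊆ U, NSet G U' = X}.ncard = (MSS G).ncard ∧
    Set.BijOn (fun S => NSet G (U ∩ S)) (MSS G) {X : Set V | ∃ U' ⊆ U, NSet G U' = X} := by
  have hbij : Set.BijOn (fun S => NSet G (U ∩ S)) (MSS G)
      {X : Set V | ∃ U' ⊆ U, NSet G U' = X} := by
    refine ⟨fun S _ => ⟨U ∩ S, Set.inter_subset_left, rfl⟩, hb.injOn_nSet_inter, ?_⟩
    rintro _ ⟨A, hA, rfl⟩
    exact hb.exists_mem_mss hA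
  refine ⟨?_, hbij⟩
  rw [← hbij.image_eq, hbij.injOn.ncard_image]
end

section
/- Let G be a finite bipartite series-parallel graph with bipartition (U, W) and at least one edge; that is, G is bipartite and contains no K₄ minor, meaning there do not exist four pairwise disjoint nonempty vertex sets B₁, B₂, B₃, B₄, each inducing a connected subgraph of G, such that for every pair i ≠ j there is an edge of G with one endpoint in B_i and one in B_j. Then both U and W contain a rare vertex. -/
/-- `M` is a minor of `G`: the vertices of `M` are modelled by pairwise disjoint connected
branch sets of `G`, with an edge of `G` between the branch sets of adjacent vertices. -/
def IsMinor {ι V : Type*} (M : SimpleGraph ι) (G : SimpleGraph V) : Prop :=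
  ∃ B : ι → Set V, (∀ i, (B i).Nonempty) ∧ (Pairwise fun i j => Disjoint (B i) (B j)) ∧
    (∀ i, (G.induce (B i)).Connected) ∧
    (∀ i j, M.Adj i j → ∃ u ∈ B i, ∃ w ∈ B j, G.Adj u w)

theorem reachable_induce_mono {V : Type*} (G : SimpleGraph V) {s t : Set V} (hst : s ⊆ t)
    {a b : V} (ha : a ∈ s) (hb : b ∈ s) (h : (G.induce s).Reachable ⟨a, ha⟩ ⟨b, hb⟩) :
    (G.induce t).Reachable ⟨a, hst ha⟩ ⟨b, hst hb⟩ :=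
  h.map (SimpleGraph.induceHomOfLE G hst).toHom

theorem IsMinor.trans {ι κ V : Type*} {K : SimpleGraph κ} {M : SimpleGraph ι}
    {G : SimpleGraph V} (h₁ : IsMinor K M) (h₂ : IsMinor M G) : IsMinor K G := by
  obtain ⟨C, hCne, hCd, hCc, hCe⟩ := h₁
  obtain ⟨B, hBne, hBd, hBc, hBe⟩ := h₂
  refine ⟨fun k => ⋃ i ∈ C k, B i, fun k => ?_, fun k l hkl => ?_, fun k => ?_, fun k l hkl => ?_⟩
  · obtain ⟨i, hi⟩ := hCne k
    obtain ⟨a, ha⟩ := hBne i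
    exact ⟨a, Set.mem_biUnion hi ha⟩
  · simp only [Set.disjoint_iUnion_left, Set.disjoint_iUnion_right]
    intro i hi j hj
    apply hBd
    rintro rfl
    exact Set.disjoint_left.mp (hCd hkl) hj hi
  · have sub : ∀ i ∈ C k, B i ⊆ ⋃ i ∈ C k, B i := fun i hi => Set.subset_biUnion_of_mem hi
    have key : ∀ i j : C k, (M.induce (C k)).Reachable i j → ∀ a (ha : a ∈ B i) b (hb : b ∈ B j),
        (G.induce (⋃ i ∈ C k, B i)).Reachable ⟨a, sub i i.2 ha⟩ ⟨b, sub j j.2 hb⟩ := by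
      rintro i j ⟨p⟩
      induction p with
      | nil =>
        intro a ha b hb
        exact reachable_induce_mono G (sub _ (Subtype.prop _)) ha hb ((hBc _).preconnected _ _)
      | @cons i j l hij p ih =>
        intro a ha b hb
        obtain ⟨c, hc, d, hd, hcd⟩ := hBe i j hij
        have h1 := reachable_induce_mono G (sub _ i.2) ha hc ((hBc _).preconnected _ _)
        have h2 : (G.induce (⋃ i ∈ C k, B i)).Adj ⟨c, sub _ i.2 hc⟩ ⟨d, sub _ j.2 hd⟩ := hcd
        exact h1.trans (h2.reachable.trans (ih d hd b hb))
    obtain ⟨i, hi⟩ := hCne k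
    obtain ⟨a, ha⟩ := hBne i
    have : Nonempty (⋃ i ∈ C k, B i : Set V) := ⟨⟨a, sub i hi ha⟩⟩
    refine SimpleGraph.Connected.mk ?_
    rintro ⟨a, ha⟩ ⟨b, hb⟩
    obtain ⟨i, hi, ha'⟩ := Set.mem_iUnion₂.mp ha
    obtain ⟨j, hj, hb'⟩ := Set.mem_iUnion₂.mp hb
    exact key ⟨i, hi⟩ ⟨j, hj⟩ ((hCc k).preconnected _ _) a ha' b hb'
  · obtain ⟨i, hi, j, hj, hij⟩ := hCe k l hkl
    obtain ⟨a, ha, b, hb, hab⟩ := hBe i j hij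
    exact ⟨a, Set.mem_biUnion hi ha, b, Set.mem_biUnion hj hb, hab⟩

/-- A minor model whose branch sets are stars, centred at the vertices of `M`. -/
theorem isMinor_of_stars {V : Type*} {G : SimpleGraph V} {p : V → Prop}
    (M : SimpleGraph {v // p v}) (A : V → Set V) (hA : ∀ v, ∀ a ∈ A v, G.Adj v a ∧ ¬ p a)
    (hd : ∀ u v a, a ∈ A u → a ∈ A v → u = v)
    (hM : ∀ u v, M.Adj u v → ∃ a ∈ insert u.1 (A u.1), ∃ b ∈ insert v.1 (A v.1), G.Adj a b) :
    IsMinor M G := by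
  refine ⟨fun v => insert v.1 (A v.1), fun v => ⟨v, Set.mem_insert _ _⟩, fun u v huv => ?_,
    fun v => ?_, hM⟩
  · refine Set.disjoint_left.mpr ?_
    rintro a (rfl | ha) (h | hb)
    · exact huv (Subtype.ext h)
    · exact (hA _ _ hb).2 u.2
    · subst h
      exact (hA _ _ ha).2 v.2
    · exact huv (Subtype.ext (hd _ _ _ ha hb))
  · have key : ∀ a : (insert v.1 (A v.1) : Set V), (G.induce (insert v.1 (A v.1))).Reachable
        ⟨v.1, Set.mem_insert _ _⟩ a := by
      rintro ⟨a, rfl | ha⟩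
      · exact SimpleGraph.Reachable.refl _
      · exact SimpleGraph.Adj.reachable (G := G.induce (insert v.1 (A v.1))) (hA _ _ ha).1
    have : Nonempty (insert v.1 (A v.1) : Set V) := ⟨⟨v.1, Set.mem_insert _ _⟩⟩
    exact SimpleGraph.Connected.mk fun a b => (key a).symm.trans (key b)

theorem isMinor_top_of_clique {V : Type*} {G : SimpleGraph V} {a b c d : V}
    (hab : G.Adj a b) (hac : G.Adj a c) (had : G.Adj a d) (hbc : G.Adj b c) (hbd : G.Adj b d)
    (hcd : G.Adj c d) : IsMinor (⊤ : SimpleGraph (Fin 4)) G := by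
  have adj : ∀ i j : Fin 4, i ≠ j → G.Adj (![a, b, c, d] i) (![a, b, c, d] j) := by
    intro i j hij
    fin_cases i <;> fin_cases j <;>
      first
        | exact absurd rfl hij
        | (simp; first | assumption | (apply SimpleGraph.Adj.symm; assumption))
  refine ⟨fun i => {![a, b, c, d] i}, fun i => Set.singleton_nonempty _, fun i j hij => ?_,
    fun i => ?_, fun i j hij => ?_⟩
  · exact Set.disjoint_singleton.mpr (adj i j hij).ne
  · have : Nonempty ({![a, b, c, d] i} : Set V) := ⟨⟨_, rfl⟩⟩
    refine SimpleGraph.Connected.mk ?_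
    rintro ⟨x, rfl⟩ ⟨y, rfl⟩
    exact SimpleGraph.Reachable.refl _
  · exact ⟨_, rfl, _, rfl, adj i j hij⟩

theorem three_le_ncard_of_subset {V : Type*} [Finite V] {s t : Set V} (h : s ⊆ t)
    (hs : 3 ≤ s.ncard) : 3 ≤ t.ncard :=
  hs.trans (Set.ncard_le_ncard h)

theorem three_le_ncard_of_subset_image_val {V : Type*} [Finite V] {p : V → Prop} {s : Set V}
    {t : Set {v // p v}} (h : s ⊆ Subtype.val '' t) (hs : 3 ≤ s.ncard) : 3 ≤ t.ncard := by
  rw [← Set.ncard_image_of_injective t Subtype.val_injective]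
  exact three_le_ncard_of_subset h hs

/-- A graph of minimum degree at least three has smaller minors of minimum degree at least
three obtained by contracting an edge `xy`, unless a common neighbour of `x` and `y` has
degree three or `x` and `y` have degree three and the same other neighbours. -/
theorem exists_contraction {V : Type} [Finite V] (G : SimpleGraph V)
    (hdeg : ∀ v, 3 ≤ (G.neighborSet v).ncard) {x y : V} (hxy : G.Adj x y)
    (hz : ∀ z, G.Adj x z → G.Adj y z → (G.neighborSet z).ncard ≠ 3)
    (hu : 3 ≤ ((G.neighborSet x ∪ G.neighborSet y) \ {x, y}).ncard) :
    ∃ M : SimpleGraph {v // v ≠ y}, IsMinor M G ∧ ∀ v, 3 ≤ (M.neighborSet v).ncard := by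
  classical
  let M : SimpleGraph {v // v ≠ y} :=
    { Adj := fun u v => u ≠ v ∧ (G.Adj u v ∨ (u.1 = x ∧ G.Adj y v) ∨ (v.1 = x ∧ G.Adj y u))
      symm := ⟨fun u v h => ⟨h.1.symm, by
        rcases h.2 with h | h | h
        · exact Or.inl h.symm
        · exact Or.inr (Or.inr h)
        · exact Or.inr (Or.inl h)⟩⟩
      loopless := ⟨fun u h => h.1 rfl⟩ }
  refine ⟨M, ?_, ?_⟩
  · refine isMinor_of_stars M (fun v => if v = x then {y} else ∅) ?_ ?_ ?_
    · intro v a ha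
      split_ifs at ha with h
      · obtain rfl : a = y := ha
        subst h
        simpa using hxy
      · exact ha.elim
    · intro u v a hu hv
      split_ifs at hu hv with h1 h2
      · rw [h1, h2]
      · exact hv.elim
      · exact hu.elim
      · exact hu.elim
    · rintro ⟨u, hu⟩ ⟨v, hv⟩ ⟨-, h | ⟨h, h'⟩ | ⟨h, h'⟩⟩
      · exact ⟨u, Set.mem_insert _ _, v, Set.mem_insert _ _, h⟩
      · exact ⟨y, by simp_all, v, Set.mem_insert _ _, h'⟩
      · exact ⟨u, Set.mem_insert _ _, y, by simp_all, h'.symm⟩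
  · rintro ⟨v, hv⟩
    by_cases hvx : v = x
    · subst hvx
      refine three_le_ncard_of_subset_image_val ?_ hu
      rintro a ⟨ha | ha, ha'⟩ <;> simp only [Set.mem_insert_iff, Set.mem_singleton_iff, not_or] at ha'
      · exact ⟨⟨a, ha'.2⟩, ⟨fun h => ha'.1 (congrArg Subtype.val h).symm, Or.inl ha⟩, rfl⟩
      · exact ⟨⟨a, ha'.2⟩, ⟨fun h => ha'.1 (congrArg Subtype.val h).symm,
          Or.inr (Or.inl ⟨rfl, ha⟩)⟩, rfl⟩
    · have sub : G.neighborSet v \ {y} ⊆ Subtype.val '' (M.neighborSet ⟨v, hv⟩) := by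
        rintro a ⟨ha, ha'⟩
        exact ⟨⟨a, ha'⟩, ⟨fun h => ha.ne (congrArg Subtype.val h), Or.inl ha⟩, rfl⟩
      by_cases hvy : G.Adj v y
      · have hc : (G.neighborSet v \ {y}).ncard + 1 = (G.neighborSet v).ncard :=
          Set.ncard_sdiff_singleton_add_one (by exact hvy) (Set.toFinite _)
        have hv3 := hdeg v
        by_cases hvx' : G.Adj v x
        · have := hz v hvx'.symm hvy.symm
          exact three_le_ncard_of_subset_image_val sub (by omega)
        · have hx : x ∉ G.neighborSet v \ {y} := fun h => hvx' h.1
          refine three_le_ncard_of_subset_image_val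
            (s := insert x (G.neighborSet v \ {y})) ?_ ?_
          · refine Set.insert_subset ⟨⟨x, hxy.ne⟩, ⟨?_, Or.inr (Or.inr ⟨rfl, hvy.symm⟩)⟩, rfl⟩ sub
            exact fun h => hvx (congrArg Subtype.val h)
          · rw [Set.ncard_insert_of_notMem hx]
            omega
      · refine three_le_ncard_of_subset_image_val sub ?_
        rw [Set.sdiff_singleton_eq_self (by exact hvy)]
        exact hdeg v

/-- Replacing a diamond with nonadjacent ends `p` and `q` of degree at least four by an edge. -/
theorem exists_diamond_reduction {V : Type} [Finite V] (G : SimpleGraph V)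
    (hdeg : ∀ v, 3 ≤ (G.neighborSet v).ncard) {x y p q : V} (hx : G.neighborSet x = {y, p, q})
    (hy : G.neighborSet y = {x, p, q}) (hpq : p ≠ q) (hnpq : ¬ G.Adj p q)
    (hp : (G.neighborSet p).ncard ≠ 3) (hq : (G.neighborSet q).ncard ≠ 3) :
    ∃ M : SimpleGraph {v // v ≠ x ∧ v ≠ y}, IsMinor M G ∧ ∀ v, 3 ≤ (M.neighborSet v).ncard := by
  classical
  have ax : ∀ v, G.Adj x v ↔ v = y ∨ v = p ∨ v = q := fun v => by
    rw [← SimpleGraph.mem_neighborSet, hx]; rfl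
  have ay : ∀ v, G.Adj y v ↔ v = x ∨ v = p ∨ v = q := fun v => by
    rw [← SimpleGraph.mem_neighborSet, hy]; rfl
  have hxy : G.Adj x y := (ax y).2 (Or.inl rfl)
  have hxp : G.Adj x p := (ax p).2 (by simp)
  have hxq : G.Adj x q := (ax q).2 (by simp)
  have hyp : G.Adj y p := (ay p).2 (by simp)
  have hyq : G.Adj y q := (ay q).2 (by simp)
  let M : SimpleGraph {v // v ≠ x ∧ v ≠ y} :=
    { Adj := fun u v => G.Adj u v ∨ (u.1 = p ∧ v.1 = q) ∨ (u.1 = q ∧ v.1 = p)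
      symm := ⟨fun u v h => by
        rcases h with h | h | h
        · exact Or.inl h.symm
        · exact Or.inr (Or.inr h.symm)
        · exact Or.inr (Or.inl h.symm)⟩
      loopless := ⟨fun u h => by
        rcases h with h | h | h
        · exact h.ne rfl
        · exact hpq (h.1.symm.trans h.2)
        · exact hpq (h.2.symm.trans h.1)⟩ }
  refine ⟨M, ?_, ?_⟩
  · refine isMinor_of_stars M (fun v => if v = p then {x} else ∅) ?_ ?_ ?_
    · intro v a ha
      split_ifs at ha with h
      · obtain rfl : a = x := ha
        subst h
        exact ⟨hxp.symm, by simp⟩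
      · exact ha.elim
    · intro u v a hu hv
      split_ifs at hu hv with h1 h2
      · rw [h1, h2]
      · exact hv.elim
      · exact hu.elim
      · exact hu.elim
    · rintro ⟨u, hu⟩ ⟨v, hv⟩ (h | ⟨h, h'⟩ | ⟨h, h'⟩)
      · exact ⟨u, Set.mem_insert _ _, v, Set.mem_insert _ _, h⟩
      · exact ⟨x, by simp_all, v, Set.mem_insert _ _, by simp_all⟩
      · exact ⟨u, Set.mem_insert _ _, x, by simp_all, by simp_all [G.adj_comm]⟩
  · have ends : ∀ (v r : V) (hv : v ≠ x ∧ v ≠ y) (hr : r ≠ x ∧ r ≠ y), G.Adj v x → G.Adj v y →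
        ¬ G.Adj v r → (G.neighborSet v).ncard ≠ 3 → M.Adj ⟨v, hv⟩ ⟨r, hr⟩ →
        3 ≤ (M.neighborSet ⟨v, hv⟩).ncard := by
      intro v r hv hr hvx hvy hvr h3 hM
      have h1 : (G.neighborSet v \ {x}).ncard + 1 = (G.neighborSet v).ncard :=
        Set.ncard_sdiff_singleton_add_one (by exact hvx) (Set.toFinite _)
      have h2 : ((G.neighborSet v \ {x}) \ {y}).ncard + 1 = (G.neighborSet v \ {x}).ncard :=
        Set.ncard_sdiff_singleton_add_one ⟨hvy, hxy.ne.symm⟩ (Set.toFinite _)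
      refine three_le_ncard_of_subset_image_val
        (s := insert r ((G.neighborSet v \ {x}) \ {y})) ?_ ?_
      · refine Set.insert_subset ⟨⟨r, hr⟩, hM, rfl⟩ ?_
        rintro a ⟨⟨ha, hax⟩, hay⟩
        exact ⟨⟨a, hax, hay⟩, Or.inl ha, rfl⟩
      · rw [Set.ncard_insert_of_notMem fun h => hvr h.1.1]
        have := hdeg v
        omega
    rintro ⟨v, hv⟩
    by_cases hvp : v = p
    · subst hvp
      exact ends v q hv ⟨hxq.ne.symm, hyq.ne.symm⟩ hxp.symm hyp.symm hnpq hp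
        (Or.inr (Or.inl ⟨rfl, rfl⟩))
    by_cases hvq : v = q
    · subst hvq
      exact ends v p hv ⟨hxp.ne.symm, hyp.ne.symm⟩ hxq.symm hyq.symm (fun h => hnpq h.symm) hq
        (Or.inr (Or.inr ⟨rfl, rfl⟩))
    refine three_le_ncard_of_subset_image_val (s := G.neighborSet v) ?_ (hdeg v)
    intro a ha
    refine ⟨⟨a, ?_, ?_⟩, Or.inl ha, rfl⟩
    · rintro rfl
      rcases (ax v).1 (G.adj_symm ha) with h | h | h
      · exact hv.2 h
      · exact hvp h
      · exact hvq h
    · rintro rfl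
      rcases (ay v).1 (G.adj_symm ha) with h | h | h
      · exact hv.1 h
      · exact hvp h
      · exact hvq h

theorem exists_eq_insert_pair {V : Type*} [Finite V] {s : Set V} {x : V} (hx : x ∈ s)
    (hs : s.ncard = 3) : ∃ p q, p ≠ q ∧ p ≠ x ∧ q ≠ x ∧ s = {x, p, q} := by
  have h : (s \ {x}).ncard = 2 := by
    have := Set.ncard_sdiff_singleton_add_one hx (Set.toFinite _)
    omega
  obtain ⟨p, q, hpq, h⟩ := Set.ncard_eq_two.mp h
  have hp : p ∈ s \ {x} := by rw [h]; simp
  have hq : q ∈ s \ {x} := by rw [h]; simp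
  refine ⟨p, q, hpq, hp.2, hq.2, ?_⟩
  rw [← h, Set.insert_sdiff_singleton, Set.insert_eq_of_mem hx]

/-- **Dirac's theorem**: a graph of minimum degree at least three has a `K₄` minor. -/
theorem isMinor_top_of_three_le_degree (n : ℕ) : ∀ {V : Type} [Finite V] [Nonempty V]
    (G : SimpleGraph V), Nat.card V = n → (∀ v, 3 ≤ (G.neighborSet v).ncard) →
    IsMinor (⊤ : SimpleGraph (Fin 4)) G := by
  induction n using Nat.strong_induction_on with
  | _ n ih =>
    intro V _ _ G hn hdeg
    by_contra hK
    have smaller : ∀ (p : V → Prop) (x y : V), p x → ¬ p y → ∀ M : SimpleGraph {v // p v},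
        ¬ (IsMinor M G ∧ ∀ v, 3 ≤ (M.neighborSet v).ncard) := by
      rintro p x y hx hy M ⟨hM, hMd⟩
      have : Nonempty {v // p v} := ⟨⟨x, hx⟩⟩
      have hlt : Nat.card {v // p v} < n := by
        rw [← hn]
        exact Finite.card_subtype_lt hy
      exact hK ((ih _ hlt M rfl hMd).trans hM)
    have edge : ∀ x y, G.Adj x y →
        (∃ z, G.Adj x z ∧ G.Adj y z ∧ (G.neighborSet z).ncard = 3) ∨
        ∃ p q, p ≠ q ∧ G.neighborSet x = {y, p, q} ∧ G.neighborSet y = {x, p, q} := by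
      intro x y hxy
      by_contra! hcon
      by_cases hu : 3 ≤ ((G.neighborSet x ∪ G.neighborSet y) \ {x, y}).ncard
      · obtain ⟨M, hM⟩ := exists_contraction G hdeg hxy (fun z h1 h2 => hcon.1 z h1 h2) hu
        exact smaller _ x y hxy.ne (by simp) M hM
      · set s := (G.neighborSet x ∪ G.neighborSet y) \ {x, y} with hs
        have key : ∀ a b, G.Adj a b → (G.neighborSet a \ {b} ⊆ s) →
            G.neighborSet a \ {b} = s ∧ s.ncard = 2 := by
          intro a b hab hsub
          have h1 := Set.ncard_sdiff_singleton_add_one (s := G.neighborSet a) (a := b)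
            (by exact hab) (Set.toFinite _)
          have h2 := hdeg a
          have h3 := Set.ncard_le_ncard hsub (Set.toFinite _)
          exact ⟨Set.eq_of_subset_of_ncard_le hsub (by omega) (Set.toFinite _), by omega⟩
        obtain ⟨h1, h2⟩ := key x y hxy (by
          rintro a ⟨ha, hay⟩
          exact ⟨Or.inl ha, by rintro (h | h); exacts [ha.ne h.symm, hay h]⟩)
        obtain ⟨h3, -⟩ := key y x hxy.symm (by
          rintro a ⟨ha, hax⟩
          exact ⟨Or.inr ha, by rintro (h | h); exacts [hax h, ha.ne h.symm]⟩)
        obtain ⟨p, q, hpq, hs'⟩ := Set.ncard_eq_two.mp h2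
        refine hcon.2 p q hpq ?_ ?_
        · rw [← hs', ← h1, Set.insert_sdiff_singleton, Set.insert_eq_of_mem (by exact hxy)]
        · rw [← hs', ← h3, Set.insert_sdiff_singleton, Set.insert_eq_of_mem (by exact hxy.symm)]
    have common : ∀ x y, G.Adj x y → ∃ z, G.Adj x z ∧ G.Adj y z := by
      intro x y hxy
      rcases edge x y hxy with ⟨z, h1, h2, -⟩ | ⟨p, q, -, h1, h2⟩
      · exact ⟨z, h1, h2⟩
      · refine ⟨p, ?_, ?_⟩
        · rw [← SimpleGraph.mem_neighborSet, h1]; simp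
        · rw [← SimpleGraph.mem_neighborSet, h2]; simp
    have diamond : ∀ x y p q, p ≠ q → G.neighborSet x = {y, p, q} →
        G.neighborSet y = {x, p, q} → False := by
      intro x y p q hpq hx hy
      have ax : ∀ v, G.Adj x v ↔ v = y ∨ v = p ∨ v = q := fun v => by
        rw [← SimpleGraph.mem_neighborSet, hx]; rfl
      have ay : ∀ v, G.Adj y v ↔ v = x ∨ v = p ∨ v = q := fun v => by
        rw [← SimpleGraph.mem_neighborSet, hy]; rfl
      have hxy : G.Adj x y := (ax y).2 (Or.inl rfl)
      have hxp : G.Adj x p := (ax p).2 (by simp)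
      have hxq : G.Adj x q := (ax q).2 (by simp)
      have hyp : G.Adj y p := (ay p).2 (by simp)
      have hyq : G.Adj y q := (ay q).2 (by simp)
      have hnpq : ¬ G.Adj p q := fun h => hK (isMinor_top_of_clique hxy hxp hxq hyp hyq h)
      have ends : ∀ v, (v = p ∨ v = q) → (G.neighborSet v).ncard ≠ 3 := by
        intro v hv h3
        have hvx : G.Adj v x := by rcases hv with rfl | rfl <;> exact G.adj_symm ‹_›
        have hvy : G.Adj v y := by rcases hv with rfl | rfl <;> exact G.adj_symm ‹_›
        obtain ⟨c, d, hcd, hcx, hdx, hN⟩ := exists_eq_insert_pair (s := G.neighborSet v)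
          (by exact hvx) h3
        have av : ∀ u, G.Adj v u ↔ u = x ∨ u = c ∨ u = d := fun u => by
          rw [← SimpleGraph.mem_neighborSet, hN]; rfl
        obtain ⟨r, hvr, hrx, hry⟩ : ∃ r, G.Adj v r ∧ r ≠ x ∧ r ≠ y := by
          by_cases hc : c = y
          · exact ⟨d, (av d).2 (by simp), hdx, fun h => hcd (hc.trans h.symm)⟩
          · exact ⟨c, (av c).2 (by simp), hcx, hc⟩
        obtain ⟨t, hvt, hrt⟩ := common v r hvr
        have ht : t = x ∨ t = y := by
          have h1 := (av t).1 hvt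
          have h2 := (av r).1 hvr
          have h3 := (av y).1 hvy
          have h4 := hrt.ne
          have h5 := hxy.ne
          grind
        have hrpq : r = p ∨ r = q := by
          rcases ht with rfl | rfl
          · exact ((ax r).1 hrt.symm).resolve_left hry
          · exact ((ay r).1 hrt.symm).resolve_left hrx
        rcases hv with rfl | rfl <;> rcases hrpq with rfl | rfl
        · exact hvr.ne rfl
        · exact hnpq hvr
        · exact hnpq hvr.symm
        · exact hvr.ne rfl
      obtain ⟨M, hM⟩ := exists_diamond_reduction G hdeg hx hy hpq hnpq (ends p (Or.inl rfl))
        (ends q (Or.inr rfl))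
      exact smaller _ p x ⟨hxp.ne.symm, hyp.ne.symm⟩ (by simp) M hM
    have edge' : ∀ x y, G.Adj x y → ∃ z, G.Adj x z ∧ G.Adj y z ∧ (G.neighborSet z).ncard = 3 := by
      intro x y hxy
      refine (edge x y hxy).resolve_right ?_
      rintro ⟨p, q, hpq, h1, h2⟩
      exact diamond x y p q hpq h1 h2
    obtain ⟨v⟩ := ‹Nonempty V›
    obtain ⟨u, hu⟩ : (G.neighborSet v).Nonempty := by
      apply Set.nonempty_of_ncard_ne_zero
      have := hdeg v
      omega
    obtain ⟨z, hvz, -, hz⟩ := edge' v u hu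
    obtain ⟨a, b, hab, hav, hbv, hN⟩ := exists_eq_insert_pair (s := G.neighborSet z)
      (by exact hvz.symm) hz
    have az : ∀ u, G.Adj z u ↔ u = v ∨ u = a ∨ u = b := fun u => by
      rw [← SimpleGraph.mem_neighborSet, hN]; rfl
    have center : ∀ c d e, (∀ u, G.Adj z u ↔ u = c ∨ u = d ∨ u = e) → c ≠ d → c ≠ e → d ≠ e →
        G.Adj c d → G.Adj c e → (G.neighborSet c).ncard = 3 → False := by
      intro c d e h hcd hce hde h1 h2 h3
      have hzc : G.Adj z c := (h c).2 (by simp)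
      have hzd : G.Adj z d := (h d).2 (by simp)
      have hze : G.Adj z e := (h e).2 (by simp)
      refine diamond z c d e hde (Set.ext h) ?_
      symm
      apply Set.eq_of_subset_of_ncard_le
      · rintro u (rfl | rfl | rfl)
        exacts [hzc.symm, h1, h2]
      · rw [h3, Set.ncard_eq_three.mpr ⟨z, d, e, hzd.ne, hze.ne, hde, rfl⟩]
      · exact Set.toFinite _
    have hclique : ¬ (G.Adj v a ∧ G.Adj v b ∧ G.Adj a b) := fun ⟨h1, h2, h3⟩ =>
      hK (isMinor_top_of_clique ((az v).2 (by simp)) ((az a).2 (by simp)) ((az b).2 (by simp))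
        h1 h2 h3)
    have cv := center v a b az hav.symm hbv.symm hab
    have ca := center a v b (fun u => (az u).trans or_left_comm) hav hab hbv.symm
    have cb := center b v a (fun u => (az u).trans or_rotate.symm) hbv hab.symm hav.symm
    have third : ∀ c d e, (∀ u, G.Adj z u ↔ u = c ∨ u = d ∨ u = e) →
        (G.Adj c d ∧ (G.neighborSet d).ncard = 3) ∨ (G.Adj c e ∧ (G.neighborSet e).ncard = 3) := by
      intro c d e h
      obtain ⟨t, hzt, hct, ht⟩ := edge' z c ((h c).2 (by simp))
      rcases (h t).1 hzt with rfl | rfl | rfl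
      · exact (hct.ne rfl).elim
      · exact Or.inl ⟨hct, ht⟩
      · exact Or.inr ⟨hct, ht⟩
    have tv := third v a b az
    have ta := third a v b (fun u => (az u).trans or_left_comm)
    have tb := third b v a (fun u => (az u).trans or_rotate.symm)
    rw [G.adj_comm a v] at ca ta
    rw [G.adj_comm b v, G.adj_comm b a] at cb tb
    clear third center diamond edge edge' common smaller az
    grind

/-- A bipartite graph with an edge and without `K₄` minor has a vertex `w` in the prescribed
class such that two neighbours of `w` dominate the second neighbourhood of `w`. -/
theorem exists_dominating_pair {V : Type} [Finite V] (G : SimpleGraph V)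
    (U W : Set V) (hb : IsBipartition G U W) (he : G.edgeSet.Nonempty)
    (hK : ¬ IsMinor (⊤ : SimpleGraph (Fin 4)) G) :
    ∃ w ∈ W, ∃ u₁ u₂, G.Adj w u₁ ∧ G.Adj w u₂ ∧
      ∀ u, G.Adj w u → G.neighborSet u ⊆ G.neighborSet u₁ ∪ G.neighborSet u₂ := by
  classical
  obtain ⟨hUW, hd, hU, hW⟩ := hb
  have hdis : ∀ v, v ∈ U → v ∈ W → False := fun v h1 h2 => Set.disjoint_left.mp hd h1 h2
  have hor : ∀ v, v ∈ U ∨ v ∈ W := fun v => by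
    have : v ∈ U ∪ W := by rw [hUW]; trivial
    exact this
  have nU : ∀ u v, u ∈ U → G.Adj u v → v ∈ W := fun u v hu h =>
    (hor v).resolve_left fun hv => hU hu hv h
  have nW : ∀ u v, u ∈ W → G.Adj u v → v ∈ U := fun u v hu h =>
    (hor v).resolve_right fun hv => hW hu hv h
  by_contra! hcon
  apply hK
  have hrep : ∃ rep : V → V, (∀ u, G.neighborSet (rep u) = G.neighborSet u) ∧
      ∀ u v, G.neighborSet u = G.neighborSet v → rep u = rep v := by
    have hex : ∀ s : Set V, ∃ r, ∀ u, G.neighborSet u = s → G.neighborSet r = s := by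
      intro s
      by_cases h : ∃ u, G.neighborSet u = s
      · obtain ⟨u, hu⟩ := h
        exact ⟨u, fun _ _ => hu⟩
      · obtain ⟨e, -⟩ := he
        exact ⟨e.out.1, fun u hu => (h ⟨u, hu⟩).elim⟩
    choose r hr using hex
    exact ⟨fun u => r (G.neighborSet u), fun u => hr _ u rfl, fun u v h => by simp only [h]⟩
  obtain ⟨rep, hrepN, hrepE⟩ := hrep
  have hex : ∀ u, ∃ c, (G.neighborSet u).Nonempty → G.Adj u c := by
    intro u
    by_cases h : (G.neighborSet u).Nonempty
    · obtain ⟨c, hc⟩ := h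
      exact ⟨c, fun _ => hc⟩
    · exact ⟨u, fun h' => (h h').elim⟩
  choose owner howner using hex
  let p : V → Prop := fun v => (v ∈ W ∧ (G.neighborSet v).Nonempty) ∨
    (v ∈ U ∧ rep v = v ∧ 3 ≤ (G.neighborSet v).ncard)
  let M : SimpleGraph {v // p v} :=
    { Adj := fun a b => G.Adj a b ∨ (a ≠ b ∧ ∃ u ∈ U, G.neighborSet u = {a.1, b.1})
      symm := ⟨fun a b h => by
        rcases h with h | ⟨h, u, hu, hN⟩
        · exact Or.inl h.symm
        · exact Or.inr ⟨h.symm, u, hu, by rw [hN, Set.pair_comm]⟩⟩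
      loopless := ⟨fun a h => by
        rcases h with h | ⟨h, -⟩
        · exact h.ne rfl
        · exact h rfl⟩ }
  have hM : IsMinor M G := by
    refine isMinor_of_stars M (fun v => {u | u ∈ U ∧ rep u = u ∧ (G.neighborSet u).ncard = 2 ∧
      owner u = v}) ?_ ?_ ?_
    · rintro v a ⟨haU, -, ha2, rfl⟩
      refine ⟨(howner a (Set.nonempty_of_ncard_ne_zero (by omega))).symm, ?_⟩
      rintro (h | h)
      · exact hdis a haU h.1
      · omega
    · rintro u v a ⟨-, -, -, rfl⟩ ⟨-, -, -, rfl⟩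
      rfl
    · rintro a b (h | ⟨hab, u, hu, hN⟩)
      · exact ⟨a, Set.mem_insert _ _, b, Set.mem_insert _ _, h⟩
      · have hab' : a.1 ≠ b.1 := fun h => hab (Subtype.ext h)
        have hN' := (hrepN u).trans hN
        have ar : ∀ v, G.Adj (rep u) v ↔ v = a.1 ∨ v = b.1 := fun v => by
          rw [← SimpleGraph.mem_neighborSet, hN']; rfl
        have ha : G.Adj (rep u) a := (ar _).2 (Or.inl rfl)
        have hb' : G.Adj (rep u) b := (ar _).2 (Or.inr rfl)
        have hau : G.Adj u a := by rw [← SimpleGraph.mem_neighborSet, hN]; simp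
        have hrU : rep u ∈ U := nW _ _ (nU _ _ hu hau) ha.symm
        have hr2 : (G.neighborSet (rep u)).ncard = 2 := by rw [hN', Set.ncard_pair hab']
        have hrr : rep (rep u) = rep u := hrepE _ _ (hrepN u)
        rcases (ar _).1 (howner (rep u) ⟨_, ha⟩) with h | h
        · exact ⟨rep u, Or.inr ⟨hrU, hrr, hr2, h⟩, b, Set.mem_insert _ _, hb'⟩
        · exact ⟨a, Set.mem_insert _ _, rep u, Or.inr ⟨hrU, hrr, hr2, h⟩, ha.symm⟩
  have hMd : ∀ v, 3 ≤ (M.neighborSet v).ncard := by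
    rintro ⟨v, hv⟩
    rcases hv with ⟨hvW, hne⟩ | ⟨hvU, hvr, hv3⟩
    · obtain ⟨u₀, hu₀⟩ := hne
      have pick : ∀ u₁ u₂, G.Adj v u₁ → G.Adj v u₂ → ∃ u, G.Adj v u ∧
          2 ≤ (G.neighborSet u).ncard ∧ G.neighborSet u ≠ G.neighborSet u₁ ∧
          G.neighborSet u ≠ G.neighborSet u₂ := by
        intro u₁ u₂ h₁ h₂
        obtain ⟨u, hu, hns⟩ := hcon v hvW u₁ u₂ h₁ h₂
        obtain ⟨c, hc, hc'⟩ := Set.not_subset.mp hns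
        refine ⟨u, hu, ?_, fun h => hc' (Or.inl (h ▸ hc)), fun h => hc' (Or.inr (h ▸ hc))⟩
        have hcv : c ≠ v := by
          rintro rfl
          exact hc' (Or.inl h₁.symm)
        rw [← Set.ncard_pair hcv]
        refine Set.ncard_le_ncard ?_ (Set.toFinite _)
        rintro x (rfl | rfl)
        exacts [hc, hu.symm]
      obtain ⟨a, ha, ha2, -, -⟩ := pick u₀ u₀ hu₀ hu₀
      obtain ⟨b, hb, hb2, hba, -⟩ := pick a a ha ha
      obtain ⟨c, hc, hc2, hca, hcb⟩ := pick a b ha hb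
      have image : ∀ u, G.Adj v u → 2 ≤ (G.neighborSet u).ncard →
          ∃ m, M.Adj ⟨v, Or.inl ⟨hvW, ⟨u₀, hu₀⟩⟩⟩ m ∧
            ((m.1 ∈ U ∧ G.neighborSet m.1 = G.neighborSet u) ∨
              (m.1 ∈ W ∧ G.neighborSet u = {v, m.1})) := by
        intro u hu h2
        have huU := nW _ _ hvW hu
        rcases h2.eq_or_lt with h2 | h3
        · have h1 : (G.neighborSet u \ {v}).ncard = 1 := by
            have := Set.ncard_sdiff_singleton_add_one (s := G.neighborSet u) (a := v)
              (by exact hu.symm) (Set.toFinite _)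
            omega
          obtain ⟨x, hx⟩ := Set.ncard_eq_one.mp h1
          have hx' : x ∈ G.neighborSet u \ {v} := by rw [hx]; rfl
          have hN : G.neighborSet u = {v, x} := by
            rw [← hx, Set.insert_sdiff_singleton, Set.insert_eq_of_mem (by exact hu.symm)]
          have hxW := nU _ _ huU hx'.1
          refine ⟨⟨x, Or.inl ⟨hxW, u, G.adj_symm hx'.1⟩⟩, Or.inr ⟨?_, u, huU, hN⟩, Or.inr ⟨hxW, hN⟩⟩
          exact fun h => hx'.2 (congrArg Subtype.val h).symm
        · have hvr : G.Adj (rep u) v := by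
            rw [← SimpleGraph.mem_neighborSet, hrepN]
            exact hu.symm
          have hrU := nW _ _ hvW hvr.symm
          refine ⟨⟨rep u, Or.inr ⟨hrU, hrepE _ _ (hrepN u), ?_⟩⟩, Or.inl hvr.symm,
            Or.inl ⟨hrU, hrepN u⟩⟩
          rw [hrepN]
          exact h3
      have inj : ∀ {u u' : V} {m m' : {v // p v}}, ((m.1 ∈ U ∧ G.neighborSet m.1 = G.neighborSet u) ∨
            (m.1 ∈ W ∧ G.neighborSet u = {v, m.1})) →
          ((m'.1 ∈ U ∧ G.neighborSet m'.1 = G.neighborSet u') ∨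
            (m'.1 ∈ W ∧ G.neighborSet u' = {v, m'.1})) →
          G.neighborSet u ≠ G.neighborSet u' → m ≠ m' := by
        rintro u u' m m' (⟨h1, h2⟩ | ⟨h1, h2⟩) (⟨h3, h4⟩ | ⟨h3, h4⟩) hne rfl
        · exact hne (h2.symm.trans h4)
        · exact hdis _ h1 h3
        · exact hdis _ h3 h1
        · exact hne (h2.trans h4.symm)
      obtain ⟨ma, hma, ta⟩ := image a ha ha2
      obtain ⟨mb, hmb, tb⟩ := image b hb hb2
      obtain ⟨mc, hmc, tc⟩ := image c hc hc2
      have h3 : ({ma, mb, mc} : Set {v // p v}).ncard = 3 := Set.ncard_eq_three.mpr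
        ⟨ma, mb, mc, inj ta tb hba.symm, inj ta tc hca.symm, inj tb tc hcb.symm, rfl⟩
      refine three_le_ncard_of_subset ?_ h3.ge
      rintro m (rfl | rfl | rfl)
      exacts [hma, hmb, hmc]
    · refine three_le_ncard_of_subset_image_val (s := G.neighborSet v) ?_ hv3
      intro w hw
      exact ⟨⟨w, Or.inl ⟨nU _ _ hvU hw, v, G.adj_symm hw⟩⟩, Or.inl hw, rfl⟩
  have hne : Nonempty {v // p v} := by
    obtain ⟨e, he⟩ := he
    induction e with
    | _ x y =>
      have hxy : G.Adj x y := he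
      rcases hor x with h | h
      · exact ⟨⟨y, Or.inl ⟨nU _ _ h hxy, x, hxy.symm⟩⟩⟩
      · exact ⟨⟨x, Or.inl ⟨h, y, hxy⟩⟩⟩
  exact (isMinor_top_of_three_le_degree _ M rfl hMd).trans hM

/-- If two neighbours of `w` dominate the second neighbourhood of `w`, one of them is rare. -/
theorem rare_or_rare_of_dominating_pair {V : Type*} [Finite V] (G : SimpleGraph V)
    (U W : Set V) (hb : IsBipartition G U W) {w u₁ u₂ : V} (hw : w ∈ W)
    (h₁ : G.Adj w u₁) (h₂ : G.Adj w u₂)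
    (hdom : ∀ u, G.Adj w u → G.neighborSet u ⊆ G.neighborSet u₁ ∪ G.neighborSet u₂) :
    Rare G u₁ ∨ Rare G u₂ := by
  classical
  obtain ⟨hUW, hd, hU, hW⟩ := hb
  have hdis : ∀ v, v ∈ U → v ∈ W → False := fun v h1 h2 => Set.disjoint_left.mp hd h1 h2
  have hor : ∀ v, v ∈ U ∨ v ∈ W := fun v => by
    have : v ∈ U ∪ W := by rw [hUW]; trivial
    exact this
  have nU : ∀ u v, u ∈ U → G.Adj u v → v ∈ W := fun u v hu h =>
    (hor v).resolve_left fun hv => hU hu hv h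
  have nW : ∀ u v, u ∈ W → G.Adj u v → v ∈ U := fun u v hu h =>
    (hor v).resolve_right fun hv => hW hu hv h
  have hNS : ∀ S ∈ MSS G, u₁ ∈ S → u₂ ∈ S → ∀ u, G.Adj w u → u ∈ S := by
    intro S hS hS₁ hS₂ u hu
    by_contra hn
    obtain ⟨x, hx, hux⟩ := hS.2 u hn
    rcases hdom u hu hux with h | h
    · exact hS.1 hS₁ hx h
    · exact hS.1 hS₂ hx h
  have mem_W_iff : ∀ S ∈ MSS G, ∀ v ∈ W, (v ∈ S ↔ ∀ u ∈ U, G.Adj v u → u ∉ S) := by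
    intro S hS v hv
    refine ⟨fun h u _ hvu hu => hS.1 h hu hvu, fun h => ?_⟩
    by_contra hn
    obtain ⟨x, hx, hvx⟩ := hS.2 v hn
    exact h x (nW _ _ hv hvx) hvx hx
  let A (a b : Prop) : Set (Set V) := {S | S ∈ MSS G ∧ (u₁ ∈ S ↔ a) ∧ (u₂ ∈ S ↔ b)}
  have hle : (A True True).ncard ≤ (A False False).ncard := by
    let f : Set V → Set V := fun S => {v | (v ∈ U ∧ v ∈ S ∧ ¬ G.Adj w v) ∨
      (v ∈ W ∧ ∀ u, G.Adj v u → u ∈ S → G.Adj w u)}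
    refine Set.ncard_le_ncard_of_injOn f ?_ ?_ (Set.toFinite _)
    · rintro S ⟨hS, -, -⟩
      have hwS : w ∈ f S := Or.inr ⟨hw, fun u hu _ => hu⟩
      have hnot : ∀ u, G.Adj w u → u ∉ f S := by
        rintro u hu (⟨-, -, h⟩ | ⟨h, -⟩)
        · exact h hu
        · exact hdis u (nW _ _ hw hu) h
      refine ⟨⟨?_, ?_⟩, iff_of_false (hnot _ h₁) id, iff_of_false (hnot _ h₂) id⟩
      · rintro u (⟨hu, huS, hwu⟩ | ⟨hu, huS⟩) v (⟨hv, hvS, hwv⟩ | ⟨hv, hvS⟩) huv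
        · exact hU hu hv huv
        · exact hwu (hvS u huv.symm huS)
        · exact hwv (huS v huv hvS)
        · exact hW hu hv huv
      · intro v hv
        rcases hor v with hvU | hvW
        · by_cases hwv : G.Adj w v
          · exact ⟨w, hwS, hwv.symm⟩
          · have hvS : v ∉ S := fun h => hv (Or.inl ⟨hvU, h, hwv⟩)
            obtain ⟨x, hx, hvx⟩ := hS.2 v hvS
            exact ⟨x, Or.inr ⟨nU _ _ hvU hvx, fun u hxu hu => (hS.1 hx hu hxu).elim⟩, hvx⟩
        · have : ¬ ∀ u, G.Adj v u → u ∈ S → G.Adj w u := fun h => hv (Or.inr ⟨hvW, h⟩)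
          push Not at this
          obtain ⟨u, hvu, huS, hwu⟩ := this
          exact ⟨u, Or.inl ⟨nW _ _ hvW hvu, huS, hwu⟩, hvu⟩
    · rintro S ⟨hS, hS₁, hS₂⟩ T ⟨hT, hT₁, hT₂⟩ hST
      have hSU : ∀ u ∈ U, (u ∈ S ↔ u ∈ T) := by
        intro u hu
        by_cases hwu : G.Adj w u
        · exact iff_of_true (hNS S hS (hS₁.2 trivial) (hS₂.2 trivial) u hwu)
            (hNS T hT (hT₁.2 trivial) (hT₂.2 trivial) u hwu)
        · have key : ∀ R : Set V, u ∈ f R ↔ u ∈ R := fun R =>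
            ⟨fun h => h.elim (fun h => h.2.1) (fun h => (hdis u hu h.1).elim),
              fun h => Or.inl ⟨hu, h, hwu⟩⟩
          rw [← key S, ← key T, hST]
      ext v
      rcases hor v with hv | hv
      · exact hSU v hv
      · rw [mem_W_iff S hS v hv, mem_W_iff T hT v hv]
        exact forall₂_congr fun u hu => by rw [hSU u hu]
  have hsplit : ∀ a b c d : Prop, ¬ ((a ↔ c) ∧ (b ↔ d)) →
      (A a b ∪ A c d).ncard = (A a b).ncard + (A c d).ncard := by
    intro a b c d h
    refine Set.ncard_union_eq ?_ (Set.toFinite _) (Set.toFinite _)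
    rw [Set.disjoint_left]
    rintro S ⟨-, h1, h2⟩ ⟨-, h3, h4⟩
    exact h ⟨h1.symm.trans h3, h2.symm.trans h4⟩
  have hm₁ : mssOn G {u₁} = (A True True).ncard + (A True False).ncard := by
    rw [← hsplit _ _ _ _ (by simp)]
    unfold mssOn
    congr 1
    ext S
    simp only [A, Set.mem_ofPred_eq, Set.mem_union, Set.singleton_subset_iff]
    tauto
  have hm₂ : mssOn G {u₂} = (A True True).ncard + (A False True).ncard := by
    rw [← hsplit _ _ _ _ (by simp)]
    unfold mssOn
    congr 1
    ext S
    simp only [A, Set.mem_ofPred_eq, Set.mem_union, Set.singleton_subset_iff]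
    tauto
  have htot : (MSS G).ncard = (A True True).ncard + (A True False).ncard +
      ((A False True).ncard + (A False False).ncard) := by
    rw [← hsplit _ _ _ _ (by simp), ← hsplit _ _ _ _ (by simp), ← Set.ncard_union_eq _
      (Set.toFinite _) (Set.toFinite _)]
    · congr 1
      ext S
      simp only [A, Set.mem_ofPred_eq, Set.mem_union]
      tauto
    · rw [Set.disjoint_left]
      rintro S (⟨-, h1, -⟩ | ⟨-, h1, -⟩) (⟨-, h2, -⟩ | ⟨-, h2, -⟩) <;> tauto
  unfold Rare
  omega

theorem exists_rare_of_isBipartition {V : Type} [Finite V] (G : SimpleGraph V)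
    (U W : Set V) (hb : IsBipartition G U W) (he : G.edgeSet.Nonempty)
    (hK : ¬ IsMinor (⊤ : SimpleGraph (Fin 4)) G) : ∃ u ∈ U, Rare G u := by
  obtain ⟨w, hw, u₁, u₂, h₁, h₂, hdom⟩ := exists_dominating_pair G U W hb he hK
  have mem : ∀ u, G.Adj w u → u ∈ U := fun u hu => by
    have : u ∈ U ∪ W := by rw [hb.1]; trivial
    exact this.resolve_right fun h => hb.2.2.2 hw h hu
  rcases rare_or_rare_of_dominating_pair G U W hb hw h₁ h₂ hdom with h | h
  · exact ⟨u₁, mem _ h₁, h⟩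
  · exact ⟨u₂, mem _ h₂, h⟩

/-- Bipartite series-parallel graphs satisfy Frankl's conjecture: if `G` is bipartite with
at least one edge and has no `K₄` minor (no four pairwise disjoint nonempty connected
vertex sets with an edge between every pair), then each bipartition class contains a rare
vertex. -/
theorem series_parallel_bipartite_frankl {V : Type} [Fintype V] (G : SimpleGraph V)
    (U W : Set V) (hb : IsBipartition G U W) (he : G.edgeSet.Nonempty)
    (hsp : ¬ ∃ B : Fin 4 → Set V, (∀ i, (B i).Nonempty) ∧
      (Pairwise fun i j => Disjoint (B i) (B j)) ∧
      (∀ i, (G.induce (B i)).Connected) ∧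
      (∀ i j, i ≠ j → ∃ u ∈ B i, ∃ w ∈ B j, G.Adj u w)) :
    (∃ u ∈ U, Rare G u) ∧ (∃ w ∈ W, Rare G w) := by
  have hK : ¬ IsMinor (⊤ : SimpleGraph (Fin 4)) G := hsp
  have hb' : IsBipartition G W U :=
    ⟨by rw [Set.union_comm]; exact hb.1, hb.2.1.symm, hb.2.2.2, hb.2.2.1⟩
  exact ⟨exists_rare_of_isBipartition G U W hb he hK, exists_rare_of_isBipartition G W U hb' he hK⟩
end
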